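/- (Double oblique second derivative bound on the boundary.) For every K > 0 there exist constants ε > 0 and C₂₄ > 0, depending only on n, Ω, Ω̃, h, h̃, θ, θ̃ and K, with the following property. Let f ∈ C²(Ω̄ × closure(Ω̃)) with ‖f‖_{C²} ≤ K satisfy condition (OSC) and sup |D_x f| ≤ ε. Let u be a smooth uniformly convex solution of the second boundary value problem with data (f, c) and let ũ be its Legendre transform. Then for every y ∈ ∂Ω̃, with β̃(y) := ∇h̃(∇ũ(y)), one has ⟨D²ũ(y)·β̃(y), β̃(y)⟩ ≤ C₂₄. -/

import Mathlib

open Set MeasureTheory Matrix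
open scoped Topology RealInnerProductSpace NNReal

noncomputable section

abbrev Euc (n : ℕ) := EuclideanSpace ℝ (Fin n)

variable {n : ℕ}

/-- Hessian matrix of `u` at `x`. -/
def Hess (u : Euc n → ℝ) (x : Euc n) : Matrix (Fin n) (Fin n) ℝ :=
  fun i j => iteratedFDeriv ℝ 2 u x ![EuclideanSpace.single i 1, EuclideanSpace.single j 1]

/-- `A ≤ B` in the sense of symmetric matrices. -/
def MatLE (A B : Matrix (Fin n) (Fin n) ℝ) : Prop := (B - A).PosSemidef

/-- The Minkowski mean-curvature operator `div (∇u / √(1 - |∇u|²))`. -/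
def MinkDiv (u : Euc n → ℝ) (x : Euc n) : ℝ :=
  ∑ i, fderiv ℝ (fun y => (Real.sqrt (1 - ‖gradient u y‖ ^ 2))⁻¹ * gradient u y i) x
    (EuclideanSpace.single i 1)

/-- The Euclidean mean-curvature operator `div (∇u / √(1 + |∇u|²))`. -/
def EucDiv (u : Euc n → ℝ) (x : Euc n) : ℝ :=
  ∑ i, fderiv ℝ (fun y => (Real.sqrt (1 + ‖gradient u y‖ ^ 2))⁻¹ * gradient u y i) x
    (EuclideanSpace.single i 1)

/-- `S(p) = (1/v)(Iₙ + p pᵀ / v²)`, `v = √(1-|p|²)`. -/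
def Smat (p : Euc n) : Matrix (Fin n) (Fin n) ℝ :=
  (Real.sqrt (1 - ‖p‖ ^ 2))⁻¹ •
    ((1 : Matrix (Fin n) (Fin n) ℝ) +
      (1 - ‖p‖ ^ 2)⁻¹ • Matrix.vecMulVec (fun i => p i) (fun j => p j))

/-- `B(p) = Iₙ + p pᵀ / (v (1 + v))`, `v = √(1-|p|²)`. -/
def Bmat (p : Euc n) : Matrix (Fin n) (Fin n) ℝ :=
  (1 : Matrix (Fin n) (Fin n) ℝ) +
    (Real.sqrt (1 - ‖p‖ ^ 2) * (1 + Real.sqrt (1 - ‖p‖ ^ 2)))⁻¹ •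
      Matrix.vecMulVec (fun i => p i) (fun j => p j)

/-- `A(x) = (1/v)·B(∇u)·D²u·B(∇u)`: its eigenvalues are the principal curvatures. -/
def Amat (u : Euc n → ℝ) (x : Euc n) : Matrix (Fin n) (Fin n) ℝ :=
  (Real.sqrt (1 - ‖gradient u x‖ ^ 2))⁻¹ •
    (Bmat (gradient u x) * Hess u x * Bmat (gradient u x))

/-- supremum of the quadratic form of `A` over the unit sphere (the operator
norm / largest eigenvalue for a positive semidefinite symmetric `A`). -/
def quadSup (A : Matrix (Fin n) (Fin n) ℝ) : ℝ :=
  ⨆ ξ : Metric.sphere (0 : Euc n) 1,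
    (fun i => (ξ : Euc n) i) ⬝ᵥ A.mulVec (fun i => (ξ : Euc n) i)

/-- The domains `Ω = {h̃ > 0}`, `Ω̃ = {h > 0}` are bounded uniformly convex domains
with smooth boundary, described by the defining functions `h̃` and `h`. -/
def DomainSetup (Ω Ωt : Set (Euc n)) (ht h : Euc n → ℝ) (θt θ : ℝ) : Prop :=
  IsOpen Ω ∧ IsOpen Ωt ∧ Bornology.IsBounded Ω ∧ Bornology.IsBounded Ωt ∧
  Ω.Nonempty ∧ Ωt.Nonempty ∧
  ContDiff ℝ (⊤ : ℕ∞) ht ∧ ContDiff ℝ (⊤ : ℕ∞) h ∧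
  Ω = {x | 0 < ht x} ∧ Ωt = {y | 0 < h y} ∧
  (∀ x ∈ frontier Ω, ‖gradient ht x‖ = 1) ∧
  (∀ y ∈ frontier Ωt, ‖gradient h y‖ = 1) ∧
  0 < θt ∧ 0 < θ ∧
  (∀ x : Euc n, MatLE (Hess ht x) ((-θt) • (1 : Matrix (Fin n) (Fin n) ℝ))) ∧
  (∀ y : Euc n, MatLE (Hess h y) ((-θ) • (1 : Matrix (Fin n) (Fin n) ℝ)))

/-- `f ∈ 𝒜`: `f` is `C²` on `Ω̄ × closure Ω̃` and concave in `x`. -/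
def InA (Ω Ωt : Set (Euc n)) (f : Euc n × Euc n → ℝ) : Prop :=
  ContDiffOn ℝ 2 f (closure Ω ×ˢ closure Ωt) ∧
  ∀ p ∈ closure Ωt, ConcaveOn ℝ (closure Ω) (fun x => f (x, p))

/-- Condition (OSC): `osc f ≤ (n/2)(|Ω̃|/|Ω|)^{1/n}`. -/
def OSCcond (Ω Ωt : Set (Euc n)) (f : Euc n × Euc n → ℝ) : Prop :=
  ∀ x ∈ closure Ω, ∀ y ∈ closure Ω, ∀ p ∈ closure Ωt, ∀ q ∈ closure Ωt,
    |f (x, p) - f (y, q)| ≤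
      ((n : ℝ) / 2) * ((volume Ωt).toReal / (volume Ω).toReal) ^ ((1 : ℝ) / n)

/-- `‖f‖_{C²(Ω̄ × closure Ω̃)} ≤ K`. -/
def C2Bound (Ω Ωt : Set (Euc n)) (f : Euc n × Euc n → ℝ) (K : ℝ) : Prop :=
  ContDiffOn ℝ 2 f (closure Ω ×ˢ closure Ωt) ∧
  ∀ z ∈ closure Ω ×ˢ closure Ωt,
    |f z| ≤ K ∧ ‖fderiv ℝ f z‖ ≤ K ∧ ‖iteratedFDeriv ℝ 2 f z‖ ≤ K

/-- `sup |D_x f| ≤ ε` on `Ω̄ × closure Ω̃`. -/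
def DxBound (Ω Ωt : Set (Euc n)) (f : Euc n × Euc n → ℝ) (ε : ℝ) : Prop :=
  ∀ x ∈ closure Ω, ∀ p ∈ closure Ωt, ‖fderiv ℝ (fun x' => f (x', p)) x‖ ≤ ε

/-- `sup |D_{xp} f| ≤ ε` on `Ω̄ × closure Ω̃`. -/
def DxpBound (Ω Ωt : Set (Euc n)) (f : Euc n × Euc n → ℝ) (ε : ℝ) : Prop :=
  ∀ x ∈ closure Ω, ∀ p ∈ closure Ωt,
    ‖fderiv ℝ (fun p' => fderiv ℝ (fun x' => f (x', p')) x) p‖ ≤ ε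

/-- A strictly convex solution of the second boundary value problem. -/
def IsStrictSol (Ω Ωt : Set (Euc n)) (f : Euc n × Euc n → ℝ) (c : ℝ) (u : Euc n → ℝ) : Prop :=
  ContDiffOn ℝ 2 u (closure Ω) ∧
  (∀ x ∈ closure Ω, (Hess u x).PosDef) ∧
  (∀ x ∈ closure Ω, ‖gradient u x‖ < 1) ∧
  (∀ x ∈ Ω, MinkDiv u x = f (x, gradient u x) + c) ∧
  gradient u '' Ω = Ωt

/-- A smooth uniformly convex solution of the second boundary value problem. -/
def IsSmoothSol (Ω Ωt : Set (Euc n)) (f : Euc n × Euc n → ℝ) (c : ℝ) (u : Euc n → ℝ) : Prop :=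
  ContDiffOn ℝ (⊤ : ℕ∞) u (closure Ω) ∧
  (∃ δ : ℝ, 0 < δ ∧ ∀ x ∈ closure Ω, MatLE (δ • (1 : Matrix (Fin n) (Fin n) ℝ)) (Hess u x)) ∧
  (∀ x ∈ closure Ω, ‖gradient u x‖ < 1) ∧
  (∀ x ∈ Ω, MinkDiv u x = f (x, gradient u x) + c) ∧
  gradient u '' Ω = Ωt

/-- A uniformly convex `C^{2}` solution of the second boundary value problem. -/
def IsUCSol (Ω Ωt : Set (Euc n)) (f : Euc n × Euc n → ℝ) (c : ℝ) (u : Euc n → ℝ) : Prop :=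
  ContDiffOn ℝ 2 u (closure Ω) ∧
  (∃ δ : ℝ, 0 < δ ∧ ∀ x ∈ closure Ω, MatLE (δ • (1 : Matrix (Fin n) (Fin n) ℝ)) (Hess u x)) ∧
  (∀ x ∈ closure Ω, ‖gradient u x‖ < 1) ∧
  (∀ x ∈ Ω, MinkDiv u x = f (x, gradient u x) + c) ∧
  gradient u '' Ω = Ωt

/-- A uniformly convex `C^{4,α}` solution of the second boundary value problem
for the Minkowski mean-curvature operator. -/
def IsC4Sol (Ω Ωt : Set (Euc n)) (f : Euc n × Euc n → ℝ) (c : ℝ) (u : Euc n → ℝ)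
    (α : ℝ) : Prop :=
  ContDiffOn ℝ 4 u (closure Ω) ∧
  (∃ C : ℝ≥0, HolderOnWith C (Real.toNNReal α) (fun x => iteratedFDeriv ℝ 4 u x) (closure Ω)) ∧
  (∃ δ : ℝ, 0 < δ ∧ ∀ x ∈ closure Ω, MatLE (δ • (1 : Matrix (Fin n) (Fin n) ℝ)) (Hess u x)) ∧
  (∀ x ∈ closure Ω, ‖gradient u x‖ < 1) ∧
  (∀ x ∈ Ω, MinkDiv u x = f (x, gradient u x) + c) ∧
  gradient u '' Ω = Ωt

/-- A uniformly convex `C^{4,α}` solution of the second boundary value problem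
for the Euclidean mean-curvature operator. -/
def IsC4SolE (Ω Ωt : Set (Euc n)) (f : Euc n × Euc n → ℝ) (c : ℝ) (u : Euc n → ℝ)
    (α : ℝ) : Prop :=
  ContDiffOn ℝ 4 u (closure Ω) ∧
  (∃ C : ℝ≥0, HolderOnWith C (Real.toNNReal α) (fun x => iteratedFDeriv ℝ 4 u x) (closure Ω)) ∧
  (∃ δ : ℝ, 0 < δ ∧ ∀ x ∈ closure Ω, MatLE (δ • (1 : Matrix (Fin n) (Fin n) ℝ)) (Hess u x)) ∧
  (∀ x ∈ Ω, EucDiv u x = f (x, gradient u x) + c) ∧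
  gradient u '' Ω = Ωt

/-- `ũ` is the Legendre transform of `u`. -/
def IsLegendre (Ω Ωt : Set (Euc n)) (u ut : Euc n → ℝ) : Prop :=
  ContDiffOn ℝ (⊤ : ℕ∞) ut (closure Ωt) ∧
  (∀ x ∈ closure Ω, ut (gradient u x) = ⟪x, gradient u x⟫ - u x) ∧
  (∀ x ∈ closure Ω, gradient ut (gradient u x) = x) ∧
  (∀ x ∈ closure Ω, Hess ut (gradient u x) = (Hess u x)⁻¹)

/-- The Hessian entries are the second Fréchet derivative. -/
lemma Hess_apply (u : Euc n → ℝ) (x : Euc n) (i j : Fin n) :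
    Hess u x i j = fderiv ℝ (fderiv ℝ u) x (EuclideanSpace.single i 1)
      (EuclideanSpace.single j 1) := by
  simp [Hess, iteratedFDeriv_two_apply]

lemma Euc.eq_sum_single (a : Euc n) :
    a = ∑ i, a i • (EuclideanSpace.single i (1 : ℝ) : Euc n) := by
  ext j
  simp [Finset.sum_apply, Pi.single_apply]

lemma Hess_dotProduct (u : Euc n → ℝ) (x a b : Euc n) :
    (fun i => a i) ⬝ᵥ (Hess u x).mulVec (fun i => b i) = fderiv ℝ (fderiv ℝ u) x a b := by
  conv_rhs => rw [Euc.eq_sum_single a, Euc.eq_sum_single b]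
  simp only [map_sum, map_smul, _root_.sum_apply, _root_.smul_apply,
    smul_eq_mul, dotProduct, mulVec, Hess_apply, Finset.mul_sum]
  rw [Finset.sum_comm]
  refine Finset.sum_congr rfl fun i _ => Finset.sum_congr rfl fun j _ => ?_
  ring

lemma inner_fderiv_gradient (u : Euc n → ℝ) (x a b : Euc n) :
    ⟪fderiv ℝ (gradient u) x a, b⟫ = fderiv ℝ (fderiv ℝ u) x a b := by
  have h : gradient u = fun y => (InnerProductSpace.toDual ℝ (Euc n)).symm (fderiv ℝ u y) := rfl
  rw [h]
  have := ((InnerProductSpace.toDual ℝ (Euc n)).symm).comp_fderiv (f := fderiv ℝ u) (x := x)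
  have h2 : (fun y => (InnerProductSpace.toDual ℝ (Euc n)).symm (fderiv ℝ u y))
    = (InnerProductSpace.toDual ℝ (Euc n)).symm ∘ (fderiv ℝ u) := rfl
  rw [h2, this]
  exact InnerProductSpace.toDual_symm_apply

lemma MatLE.inner_lower {u : Euc n → ℝ} {x : Euc n} {δ : ℝ}
    (h : MatLE (δ • (1 : Matrix (Fin n) (Fin n) ℝ)) (Hess u x)) (a : Euc n) :
    δ * ‖a‖ ^ 2 ≤ ⟪fderiv ℝ (gradient u) x a, a⟫ := by
  have h1 := h.dotProduct_mulVec_nonneg (fun i => a i)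
  rw [inner_fderiv_gradient, ← Hess_dotProduct]
  simp only [sub_mulVec, dotProduct_sub, smul_mulVec, one_mulVec, dotProduct_smul,
    smul_eq_mul] at h1
  have h2 : (fun i => a i) ⬝ᵥ (fun i => a i) = ‖a‖ ^ 2 := by
    rw [EuclideanSpace.norm_sq_eq]
    simp [dotProduct, sq]
  have h3 : star (fun i => a i) = (fun i => a i) := by ext; simp
  rw [h3, h2] at h1
  linarith

lemma MatLE.inner_upper {u : Euc n → ℝ} {x : Euc n} {δ : ℝ}
    (h : MatLE (Hess u x) ((-δ) • (1 : Matrix (Fin n) (Fin n) ℝ))) (a : Euc n) :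
    fderiv ℝ (fderiv ℝ u) x a a ≤ - δ * ‖a‖ ^ 2 := by
  have h1 := h.dotProduct_mulVec_nonneg (fun i => a i)
  rw [← Hess_dotProduct]
  simp only [sub_mulVec, dotProduct_sub, smul_mulVec, one_mulVec, dotProduct_smul,
    smul_eq_mul] at h1
  have h2 : (fun i => a i) ⬝ᵥ (fun i => a i) = ‖a‖ ^ 2 := by
    rw [EuclideanSpace.norm_sq_eq]
    simp [dotProduct, sq]
  have h3 : star (fun i => a i) = (fun i => a i) := by ext; simp
  rw [h3, h2] at h1
  linarith

lemma MatLE.Hess_isSymm {u : Euc n → ℝ} {x : Euc n} {δ : ℝ}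
    (h : MatLE (δ • (1 : Matrix (Fin n) (Fin n) ℝ)) (Hess u x)) :
    (Hess u x)ᵀ = Hess u x := by
  have h1 := h.isHermitian
  ext i j
  have h2 := congrFun (congrFun h1 i) j
  have h3 : (1 : Matrix (Fin n) (Fin n) ℝ) j i = (1 : Matrix (Fin n) (Fin n) ℝ) i j := by
    simp [Matrix.one_apply, eq_comm]
  simp only [conjTranspose_apply, Matrix.sub_apply, Matrix.smul_apply, star_trivial, h3] at h2
  rw [transpose_apply]
  exact sub_left_injective h2

lemma MatLE.inner_symm {u : Euc n → ℝ} {x : Euc n} {δ : ℝ}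
    (h : MatLE (δ • (1 : Matrix (Fin n) (Fin n) ℝ)) (Hess u x)) (a b : Euc n) :
    ⟪fderiv ℝ (gradient u) x a, b⟫ = ⟪a, fderiv ℝ (gradient u) x b⟫ := by
  rw [real_inner_comm _ a, inner_fderiv_gradient, inner_fderiv_gradient, ← Hess_dotProduct,
    ← Hess_dotProduct, dotProduct_mulVec, dotProduct_comm, ← mulVec_transpose, h.Hess_isSymm]

lemma MatLE.differentiableAt_gradient (hn : 2 ≤ n) {u : Euc n → ℝ} {x : Euc n} {δ : ℝ}
    (hδ : 0 < δ) (h : MatLE (δ • (1 : Matrix (Fin n) (Fin n) ℝ)) (Hess u x)) :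
    DifferentiableAt ℝ (gradient u) x := by
  by_contra hd
  have h1 := h.inner_lower (EuclideanSpace.single ⟨0, by omega⟩ 1)
  rw [fderiv_zero_of_not_differentiableAt hd] at h1
  simp at h1
  linarith

/-- Necessary second-order condition at a local maximum on the line. -/
lemma IsLocalMax.second_deriv_nonpos {φ φ' : ℝ → ℝ} {a : ℝ}
    (h1 : ∀ᶠ t in 𝓝 (0 : ℝ), HasDerivAt φ (φ' t) t) (h2 : HasDerivAt φ' a 0)
    (hmax : IsLocalMax φ 0) : a ≤ 0 := by
  by_contra! ha
  have e1 : deriv φ =ᶠ[𝓝 0] φ' := h1.mono fun t ht => ht.deriv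
  have e2 : deriv (deriv φ) 0 = a := by rw [e1.deriv_eq, h2.deriv]
  have hmin : IsLocalMin φ 0 := by
    refine isLocalMin_of_deriv_deriv_pos (by rw [e2]; exact ha) hmax.deriv_eq_zero ?_
    exact h1.self_of_nhds.continuousAt
  have hc : φ =ᶠ[𝓝 0] fun _ => φ 0 := by
    filter_upwards [hmin, hmax] with t h3 h4
    exact le_antisymm h4 h3
  have hd : deriv φ =ᶠ[𝓝 0] fun _ => 0 := by
    have := hc.deriv
    filter_upwards [this] with t ht
    simpa using ht
  have : deriv (deriv φ) 0 = 0 := by rw [hd.deriv_eq]; simp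
  linarith

/-- The trace of an endomorphism in the standard basis. -/
def trE (P : Euc n →L[ℝ] Euc n) : ℝ :=
  ∑ i, ⟪P (EuclideanSpace.single i 1), (EuclideanSpace.single i 1 : Euc n)⟫

section posSemidef

variable {P : Euc n →L[ℝ] Euc n}

lemma inner_sq_le_of_nonneg (hs : ∀ a b, ⟪P a, b⟫ = ⟪a, P b⟫) (hp : ∀ a, 0 ≤ ⟪P a, a⟫)
    (a b : Euc n) : ⟪P a, b⟫ ^ 2 ≤ ⟪P a, a⟫ * ⟪P b, b⟫ := by
  have key : ∀ t : ℝ, 0 ≤ ⟪P b, b⟫ * (t * t) + (2 * ⟪P a, b⟫) * t + ⟪P a, a⟫ := by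
    intro t
    have h := hp (a + t • b)
    have h2 : ⟪P b, a⟫ = ⟪P a, b⟫ := by rw [hs, real_inner_comm]
    simp only [map_add, map_smul, inner_add_left, inner_add_right, real_inner_smul_left,
      real_inner_smul_right, h2] at h
    linarith
  have := discrim_le_zero key
  simp only [discrim] at this
  nlinarith

lemma trE_nonneg (hp : ∀ a, 0 ≤ ⟪P a, a⟫) : 0 ≤ trE P :=
  Finset.sum_nonneg fun _ _ => hp _

lemma norm_apply_le_trE (hs : ∀ a b, ⟪P a, b⟫ = ⟪a, P b⟫) (hp : ∀ a, 0 ≤ ⟪P a, a⟫)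
    (a : Euc n) : ‖P a‖ ≤ trE P * ‖a‖ := by
  have h1 : ‖P a‖ ^ 2 ≤ ⟪P a, a⟫ * trE P := by
    rw [EuclideanSpace.norm_sq_eq, trE, Finset.mul_sum]
    refine Finset.sum_le_sum fun i _ => ?_
    have := inner_sq_le_of_nonneg hs hp a (EuclideanSpace.single i 1)
    simpa [EuclideanSpace.inner_single_right] using this
  have h2 := real_inner_le_norm (P a) a
  have h3 := trE_nonneg hp
  by_cases h0 : ‖P a‖ = 0
  · rw [h0]; positivity
  · have hpos : 0 < ‖P a‖ := lt_of_le_of_ne (norm_nonneg _) (Ne.symm h0)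
    have : ‖P a‖ * ‖P a‖ ≤ ‖P a‖ * (trE P * ‖a‖) := by nlinarith
    exact le_of_mul_le_mul_left this hpos

lemma trE_sq_le (hn : 2 ≤ n) (P : Euc n →L[ℝ] Euc n) :
    trE P ^ 2 / n ≤ ∑ i, ‖P (EuclideanSpace.single i 1)‖ ^ 2 := by
  have hn' : (0 : ℝ) < n := by exact_mod_cast (by omega : 0 < n)
  rw [div_le_iff₀ hn', trE]
  have h := sq_sum_le_card_mul_sum_sq (s := (Finset.univ : Finset (Fin n)))
    (f := fun i => ⟪P (EuclideanSpace.single i 1), (EuclideanSpace.single i 1 : Euc n)⟫)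
  refine h.trans ?_
  rw [Finset.card_univ, Fintype.card_fin, mul_comm]
  refine mul_le_mul_of_nonneg_right ?_ hn'.le
  refine Finset.sum_le_sum fun i _ => ?_
  have h1 := abs_real_inner_le_norm (P (EuclideanSpace.single i 1))
    (EuclideanSpace.single i 1 : Euc n)
  rw [← sq_abs]
  simp only [PiLp.norm_single, norm_one, mul_one] at h1
  gcongr

lemma inner_apply_self_le_trE (hs : ∀ a b, ⟪P a, b⟫ = ⟪a, P b⟫) (hp : ∀ a, 0 ≤ ⟪P a, a⟫)
    (a : Euc n) (ha : ‖a‖ ≤ 1) : ⟪P a, a⟫ ≤ trE P := by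
  have h1 := real_inner_le_norm (P a) a
  have h2 := norm_apply_le_trE hs hp a
  have h3 := trE_nonneg hp
  have h4 := norm_nonneg a
  have h5 := norm_nonneg (P a)
  nlinarith [mul_nonneg h3 h4]

end posSemidef

/-- `w(p) = (1 - |p|²)^{-1/2}`. -/
def lor (p : Euc n) : ℝ := (Real.sqrt (1 - ‖p‖ ^ 2))⁻¹

lemma one_le_lor {p : Euc n} (hp : ‖p‖ < 1) : 1 ≤ lor p := by
  have h0 := norm_nonneg p
  have h1 : 0 < 1 - ‖p‖ ^ 2 := by nlinarith
  rw [lor, one_le_inv₀ (Real.sqrt_pos.2 h1)]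
  rw [Real.sqrt_le_iff]
  refine ⟨zero_le_one, ?_⟩
  nlinarith

lemma hasFDerivAt_lor {p : Euc n} (hp : ‖p‖ < 1) :
    HasFDerivAt lor ((lor p) ^ 3 • (innerSL ℝ p)) p := by
  have h0 := norm_nonneg p
  have h1 : 0 < 1 - ‖p‖ ^ 2 := by nlinarith
  have hs := Real.sqrt_pos.2 h1
  have h2 : HasFDerivAt (fun q : Euc n => 1 - ‖q‖ ^ 2) (-(2 • (innerSL ℝ p))) p := by
    have := (hasStrictFDerivAt_norm_sq p).hasFDerivAt.const_sub 1
    exact this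
  have h3 := (hasDerivAt_inv hs.ne').comp_hasFDerivAt p (h2.sqrt h1.ne')
  have : HasFDerivAt lor _ p := h3
  refine this.congr_fderiv ?_
  ext b
  simp only [_root_.smul_apply, _root_.neg_apply, innerSL_apply_apply, smul_eq_mul, lor, nsmul_eq_mul]
  field_simp
  norm_num

lemma MinkDiv_eq {u : Euc n → ℝ} {x : Euc n} (hd : DifferentiableAt ℝ (gradient u) x)
    (h1 : ‖gradient u x‖ < 1) :
    MinkDiv u x = lor (gradient u x) * trE (fderiv ℝ (gradient u) x) +
      lor (gradient u x) ^ 3 *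
        ⟪gradient u x, fderiv ℝ (gradient u) x (gradient u x)⟫ := by
  have hg := hd.hasFDerivAt
  set P := fderiv ℝ (gradient u) x with hP
  set p := gradient u x with hp
  have key : ∀ i : Fin n, fderiv ℝ
      (fun y => (Real.sqrt (1 - ‖gradient u y‖ ^ 2))⁻¹ * gradient u y i) x
      (EuclideanSpace.single i 1) =
      lor p * ⟪P (EuclideanSpace.single i 1), (EuclideanSpace.single i 1 : Euc n)⟫ +
        lor p ^ 3 * (p i * ⟪p, P (EuclideanSpace.single i 1)⟫) := by
    intro i
    have hl : HasFDerivAt (fun y => lor (gradient u y)) _ x :=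
      HasFDerivAt.comp (g := lor) x (hasFDerivAt_lor h1) hg
    have hc : HasFDerivAt (fun y => gradient u y i)
        ((EuclideanSpace.proj i : Euc n →L[ℝ] ℝ).comp P) x :=
      (EuclideanSpace.proj i : Euc n →L[ℝ] ℝ).hasFDerivAt.comp x hg
    have hm := (hl.mul hc).fderiv
    have e : (fun y => (Real.sqrt (1 - ‖gradient u y‖ ^ 2))⁻¹ * gradient u y i) =
      (fun y => lor (gradient u y)) * fun y => gradient u y i := rfl
    rw [e, hm]
    simp [EuclideanSpace.inner_single_right, ← hp]
    ring
  rw [MinkDiv, Finset.sum_congr rfl fun i _ => key i, Finset.sum_add_distrib, ← Finset.mul_sum,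
    ← Finset.mul_sum, trE]
  congr 2
  have e : P p = ∑ i, p i • P (EuclideanSpace.single i 1) := by
    conv_lhs => rw [Euc.eq_sum_single p]
    simp only [map_sum, map_smul]
  rw [e, inner_sum]
  simp [real_inner_smul_right]

/-- The quantities appearing in the derivative of the equation. -/
lemma hasDerivAt_operator {g : ℝ → Euc n} {Q : ℝ → Euc n →L[ℝ] Euc n} {q : Euc n}
    {T : Euc n →L[ℝ] Euc n} (hg : HasDerivAt g q 0) (hQ : HasDerivAt Q T 0)
    (hs : ∀ a b, ⟪Q 0 a, b⟫ = ⟪a, Q 0 b⟫) (h1 : ‖g 0‖ < 1) :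
    HasDerivAt (fun t => lor (g t) * trE (Q t) + lor (g t) ^ 3 * ⟪g t, Q t (g t)⟫)
      (lor (g 0) * trE T + lor (g 0) ^ 3 * ⟪T (g 0), g 0⟫ +
        (lor (g 0) ^ 3 * ⟪g 0, q⟫ * trE (Q 0) +
          3 * lor (g 0) ^ 5 * ⟪g 0, q⟫ * ⟪g 0, Q 0 (g 0)⟫ +
          2 * lor (g 0) ^ 3 * ⟪q, Q 0 (g 0)⟫)) 0 := by
  have hl : HasDerivAt (fun t => lor (g t)) _ 0 :=
    HasFDerivAt.comp_hasDerivAt (l := lor) 0 (hasFDerivAt_lor h1) hg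
  have ht : HasDerivAt (fun t => trE (Q t)) (trE T) 0 := by
    unfold trE
    refine HasDerivAt.fun_sum fun i _ => ?_
    have := (hQ.clm_apply (hasDerivAt_const (0 : ℝ)
      (EuclideanSpace.single i 1 : Euc n))).inner ℝ
      (hasDerivAt_const (0 : ℝ) (EuclideanSpace.single i 1 : Euc n))
    simpa using this
  have hi := hg.inner ℝ (hQ.clm_apply hg)
  refine ((hl.mul ht).add ((hl.pow 3).mul hi)).congr_deriv ?_
  have e : ⟪g 0, Q 0 q⟫ = ⟪q, Q 0 (g 0)⟫ := by rw [← hs, real_inner_comm]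
  simp [inner_add_right, e, real_inner_comm (g 0) (T (g 0))]
  ring

/-- At an interior maximum of the barrier function, the second-order conditions and the
differentiated equation bound the coefficient `A`. -/
lemma coefficient_bound (hn : 2 ≤ n) {P S : Euc n →L[ℝ] Euc n} {p q : Euc n}
    {w W Λ θ A K D M τ e Fx Fp : ℝ} {Ht Hq : Euc n → ℝ}
    (hs : ∀ a b, ⟪P a, b⟫ = ⟪a, P b⟫) (hp : ∀ a, 0 ≤ ⟪P a, a⟫)
    (hmax : ∀ ξ, Ht ξ - A * (Hq (P ξ) + ⟪S ξ, ξ⟫) ≤ 0)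
    (hHt : ∀ ξ, -Λ * ‖ξ‖ ^ 2 ≤ Ht ξ) (hHq : ∀ ζ, Hq ζ ≤ -θ * ‖ζ‖ ^ 2)
    (heq : w * trE S + w ^ 3 * ⟪S p, p⟫ + (w ^ 3 * ⟪p, q⟫ * trE P +
      3 * w ^ 5 * ⟪p, q⟫ * ⟪p, P p⟫ + 2 * w ^ 3 * ⟪q, P p⟫) = Fx + Fp)
    (hFx : Fx ≤ e) (hFp : Fp ≤ K * ‖q‖) (hAq : A * ‖q‖ ≤ D)
    (hΛ : 0 ≤ Λ) (hθ : 0 ≤ θ) (hA : 0 ≤ A) (hK : 0 ≤ K)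
    (hp1 : ‖p‖ ≤ 1) (hw : 1 ≤ w) (hwW : w ≤ W) (hτ : 0 ≤ τ) (hτP : τ ≤ trE P)
    (hPM : trE P ≤ M) :
    A * (θ * (τ ^ 2 / n)) - A * e ≤
      (W * n + W ^ 3) * Λ + K * D + (3 * W ^ 3 + 3 * W ^ 5) * (D * M) := by
  have hn' : (0 : ℝ) < n := by exact_mod_cast (by omega : 0 < n)
  have hP0 : 0 ≤ trE P := trE_nonneg hp
  have hM : 0 ≤ M := hP0.trans hPM
  have hD : 0 ≤ D := (mul_nonneg hA (norm_nonneg q)).trans hAq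
  have hW : 1 ≤ W := hw.trans hwW
  -- the trace part
  have h1 : -(n : ℝ) * Λ + A * (θ * (τ ^ 2 / n)) ≤ A * trE S := by
    have hsum : ∑ i : Fin n, (-Λ + A * θ * ‖P (EuclideanSpace.single i 1)‖ ^ 2) ≤
        ∑ i : Fin n, A * ⟪S (EuclideanSpace.single i 1), (EuclideanSpace.single i 1 : Euc n)⟫ := by
      refine Finset.sum_le_sum fun i _ => ?_
      have a1 := hmax (EuclideanSpace.single i 1)
      have a2 := hHt (EuclideanSpace.single i 1)
      have a3 := mul_le_mul_of_nonneg_left (hHq (P (EuclideanSpace.single i 1))) hA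
      simp only [PiLp.norm_single, norm_one, one_pow, mul_one] at a2
      linarith
    rw [Finset.sum_add_distrib, ← Finset.mul_sum, ← Finset.mul_sum] at hsum
    simp only [Finset.sum_const, Finset.card_univ, Fintype.card_fin, nsmul_eq_mul] at hsum
    have h2 : τ ^ 2 / n ≤ ∑ i, ‖P (EuclideanSpace.single i 1)‖ ^ 2 :=
      le_trans (by gcongr) (trE_sq_le hn P)
    have h3 := mul_le_mul_of_nonneg_left h2 (mul_nonneg hA hθ)
    have h4 : A * trE S = A * ∑ i : Fin n,
      ⟪S (EuclideanSpace.single i 1), (EuclideanSpace.single i 1 : Euc n)⟫ := rfl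
    rw [h4]
    linarith
  have h2 : -Λ ≤ A * ⟪S p, p⟫ := by
    have a1 := hmax p
    have a2 := hHt p
    have a3 := mul_le_mul_of_nonneg_left (hHq (P p)) hA
    have a4 : 0 ≤ A * (θ * ‖P p‖ ^ 2) := by positivity
    have a5 : Λ * ‖p‖ ^ 2 ≤ Λ * 1 := by
      refine mul_le_mul_of_nonneg_left ?_ hΛ
      exact pow_le_one₀ (norm_nonneg _) hp1
    linarith
  have hw0 : 0 < w := by linarith
  have hw3 : w ^ 3 ≤ W ^ 3 := by gcongr
  have hw5 : w ^ 5 ≤ W ^ 5 := by gcongr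
  have hX : 0 ≤ A * (θ * (τ ^ 2 / n)) := by positivity
  have h3 : -(W * n + W ^ 3) * Λ + A * (θ * (τ ^ 2 / n)) ≤
      A * (w * trE S + w ^ 3 * ⟪S p, p⟫) := by
    have b1 := mul_le_mul_of_nonneg_left h1 hw0.le
    have b2 := mul_le_mul_of_nonneg_left h2 (pow_nonneg hw0.le 3)
    have b3 : A * (θ * (τ ^ 2 / n)) ≤ w * (A * (θ * (τ ^ 2 / n))) := le_mul_of_one_le_left hX hw
    have b4 : w * (n * Λ) ≤ W * (n * Λ) := by gcongr
    have b5 : w ^ 3 * Λ ≤ W ^ 3 * Λ := by gcongr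
    linarith
  have hPp : ‖P p‖ ≤ M :=
    (norm_apply_le_trE hs hp p).trans (by nlinarith [norm_nonneg p])
  have c1 : A * |⟪p, q⟫| ≤ D := by
    refine le_trans (mul_le_mul_of_nonneg_left ?_ hA) hAq
    exact (abs_real_inner_le_norm p q).trans (mul_le_of_le_one_left (norm_nonneg _) hp1)
  have c2 : |⟪p, P p⟫| ≤ M :=
    (abs_real_inner_le_norm p (P p)).trans
      ((mul_le_of_le_one_left (norm_nonneg _) hp1).trans hPp)
  have c3 : A * |⟪q, P p⟫| ≤ D * M := by
    calc A * |⟪q, P p⟫| ≤ A * (‖q‖ * ‖P p‖) :=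
          mul_le_mul_of_nonneg_left (abs_real_inner_le_norm _ _) hA
      _ = (A * ‖q‖) * ‖P p‖ := by ring
      _ ≤ D * M := by gcongr
  have d1 : A * (-(w ^ 3 * ⟪p, q⟫ * trE P)) ≤ W ^ 3 * (D * M) := by
    calc A * (-(w ^ 3 * ⟪p, q⟫ * trE P)) = w ^ 3 * ((A * -⟪p, q⟫) * trE P) := by ring
      _ ≤ w ^ 3 * ((A * |⟪p, q⟫|) * trE P) := by gcongr; exact neg_le_abs _
      _ ≤ W ^ 3 * (D * M) := by gcongr
  have d2 : A * (-(3 * w ^ 5 * ⟪p, q⟫ * ⟪p, P p⟫)) ≤ 3 * W ^ 5 * (D * M) := by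
    calc A * (-(3 * w ^ 5 * ⟪p, q⟫ * ⟪p, P p⟫)) = 3 * w ^ 5 * (A * -(⟪p, q⟫ * ⟪p, P p⟫)) := by ring
      _ ≤ 3 * w ^ 5 * (A * (|⟪p, q⟫| * |⟪p, P p⟫|)) := by
          gcongr; rw [← abs_mul]; exact neg_le_abs _
      _ = 3 * w ^ 5 * ((A * |⟪p, q⟫|) * |⟪p, P p⟫|) := by ring
      _ ≤ 3 * W ^ 5 * (D * M) := by gcongr
  have d3 : A * (-(2 * w ^ 3 * ⟪q, P p⟫)) ≤ 2 * W ^ 3 * (D * M) := by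
    calc A * (-(2 * w ^ 3 * ⟪q, P p⟫)) = 2 * w ^ 3 * (A * -⟪q, P p⟫) := by ring
      _ ≤ 2 * w ^ 3 * (A * |⟪q, P p⟫|) := by gcongr; exact neg_le_abs _
      _ ≤ 2 * W ^ 3 * (D * M) := by gcongr
  have d4 : A * Fx ≤ A * e := by gcongr
  have d5 : A * Fp ≤ K * D := by
    calc A * Fp ≤ A * (K * ‖q‖) := by gcongr
      _ = K * (A * ‖q‖) := by ring
      _ ≤ K * D := by gcongr
  have heqA := congrArg (A * ·) heq
  linarith

lemma ContDiffAt.gradient_top {u : Euc n → ℝ} {x : Euc n} (hu : ContDiffAt ℝ (⊤ : ℕ∞) u x) :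
    ContDiffAt ℝ (⊤ : ℕ∞) (gradient u) x := by
  have h1 : ContDiffAt ℝ (⊤ : ℕ∞) (fderiv ℝ u) x := hu.fderiv_right (m := (⊤ : ℕ∞)) (by simp)
  exact ((InnerProductSpace.toDual ℝ (Euc n)).symm.contDiff.contDiffAt).comp x h1

lemma line_eventually_mem {Ω : Set (Euc n)} (hΩ : IsOpen Ω) {x : Euc n} (hx : x ∈ Ω)
    (ξ : Euc n) : ∀ᶠ t in 𝓝 (0 : ℝ), x + t • ξ ∈ Ω := by
  have hc : ContinuousAt (fun t : ℝ => x + t • ξ) 0 := by fun_prop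
  exact hc.eventually (by simpa using hΩ.mem_nhds hx)

lemma hasDerivAt_line (x ξ : Euc n) (t : ℝ) : HasDerivAt (fun t : ℝ => x + t • ξ) ξ t := by
  simpa using ((hasDerivAt_id t).smul_const ξ).const_add x

/-- First and second order conditions at an interior local maximum of `h̃ - A h(∇u)`, together
with the derivative of the equation in the direction `∇h(∇u)`. -/
lemma interior_max_conditions {Ω : Set (Euc n)} (hΩ : IsOpen Ω) {x₀ : Euc n} (hx₀ : x₀ ∈ Ω)
    {u ht h : Euc n → ℝ} {f : Euc n × Euc n → ℝ} {c A : ℝ}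
    (hu : ∀ x ∈ Ω, ContDiffAt ℝ (⊤ : ℕ∞) u x)
    (hs : ∀ x ∈ Ω, ∀ a b, ⟪fderiv ℝ (gradient u) x a, b⟫ = ⟪a, fderiv ℝ (gradient u) x b⟫)
    (h1 : ∀ x ∈ Ω, ‖gradient u x‖ < 1)
    (heq : ∀ x ∈ Ω, MinkDiv u x = f (x, gradient u x) + c)
    (hf : DifferentiableAt ℝ f (x₀, gradient u x₀))
    (hht : ContDiff ℝ (⊤ : ℕ∞) ht) (hh : ContDiff ℝ (⊤ : ℕ∞) h)
    (hmax : IsLocalMax (fun x => ht x - A * h (gradient u x)) x₀)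
    {P : Euc n →L[ℝ] Euc n} {p β q : Euc n} (hP : P = fderiv ℝ (gradient u) x₀)
    (hp : p = gradient u x₀) (hβ : β = gradient h p) (hq : q = P β) :
    ∃ S : Euc n →L[ℝ] Euc n,
      (∀ ξ, fderiv ℝ (fderiv ℝ ht) x₀ ξ ξ -
        A * (fderiv ℝ (fderiv ℝ h) p (P ξ) (P ξ) + ⟪S ξ, ξ⟫) ≤ 0) ∧
      lor p * trE S + lor p ^ 3 * ⟪S p, p⟫ + (lor p ^ 3 * ⟪p, q⟫ * trE P +
        3 * lor p ^ 5 * ⟪p, q⟫ * ⟪p, P p⟫ + 2 * lor p ^ 3 * ⟪q, P p⟫) =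
        fderiv ℝ f (x₀, p) (β, 0) + fderiv ℝ f (x₀, p) (0, q) ∧
      A • q = gradient ht x₀ := by
  have hg : ∀ x ∈ Ω, ContDiffAt ℝ (⊤ : ℕ∞) (gradient u) x := fun x hx => (hu x hx).gradient_top
  have hgd : ∀ x ∈ Ω, HasFDerivAt (gradient u) (fderiv ℝ (gradient u) x) x := fun x hx =>
    ((hg x hx).differentiableAt (by simp)).hasFDerivAt
  have hPd : HasFDerivAt (fderiv ℝ (gradient u)) (fderiv ℝ (fderiv ℝ (gradient u)) x₀) x₀ :=
    (((hg x₀ hx₀).fderiv_right (m := (⊤ : ℕ∞)) (by simp)).differentiableAt (by simp)).hasFDerivAt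
  set T := fderiv ℝ (fderiv ℝ (gradient u)) x₀ with hT
  have hTsymm : ∀ a b, T a b = T b a := by
    intro a b
    exact ((hg x₀ hx₀).isSymmSndFDerivAt (by
      simpa using WithTop.coe_le_coe.2 (le_top : (2 : ℕ∞) ≤ ⊤))) a b
  have hTadj : ∀ a b d, ⟪T a b, d⟫ = ⟪b, T a d⟫ := by
    intro a b d
    have e : (fun x => ⟪fderiv ℝ (gradient u) x b, d⟫) =ᶠ[𝓝 x₀]
        fun x => ⟪b, fderiv ℝ (gradient u) x d⟫ := by
      filter_upwards [hΩ.mem_nhds hx₀] with x hx using hs x hx b d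
    have e1 : HasFDerivAt (fun x => ⟪fderiv ℝ (gradient u) x b, d⟫) _ x₀ :=
      (hPd.clm_apply (hasFDerivAt_const b x₀)).inner ℝ (hasFDerivAt_const d x₀)
    have e2 : HasFDerivAt (fun x => ⟪b, fderiv ℝ (gradient u) x d⟫) _ x₀ :=
      (hasFDerivAt_const b x₀).inner ℝ (hPd.clm_apply (hasFDerivAt_const d x₀))
    have e3 := (e1.congr_of_eventuallyEq e.symm).unique e2
    have e4 := DFunLike.congr_fun e3 a
    simpa using e4
  have hhd : ∀ y, HasFDerivAt h (fderiv ℝ h y) y := fun y =>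
    (hh.differentiable (by simp) y).hasFDerivAt
  have hhtd : ∀ y, HasFDerivAt ht (fderiv ℝ ht y) y := fun y =>
    (hht.differentiable (by simp) y).hasFDerivAt
  have hhd2 : ∀ y, HasFDerivAt (fderiv ℝ h) (fderiv ℝ (fderiv ℝ h) y) y := fun y =>
    ((hh.fderiv_right (m := (⊤ : ℕ∞)) (by simp)).differentiable (by simp) y).hasFDerivAt
  have hhtd2 : ∀ y, HasFDerivAt (fderiv ℝ ht) (fderiv ℝ (fderiv ℝ ht) y) y := fun y =>
    ((hht.fderiv_right (m := (⊤ : ℕ∞)) (by simp)).differentiable (by simp) y).hasFDerivAt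
  have hβ' : ∀ a, fderiv ℝ h p a = ⟪β, a⟫ := by
    intro a; rw [hβ, gradient, InnerProductSpace.toDual_symm_apply]
  refine ⟨T β, fun ξ => ?_, ?_, ?_⟩
  · -- second order condition along the line in direction `ξ`
    have hmem := line_eventually_mem hΩ hx₀ ξ
    have hd1 : ∀ᶠ t in 𝓝 (0 : ℝ), HasDerivAt
        (fun t : ℝ => ht (x₀ + t • ξ) - A * h (gradient u (x₀ + t • ξ)))
        (fderiv ℝ ht (x₀ + t • ξ) ξ - A * fderiv ℝ h (gradient u (x₀ + t • ξ))
          (fderiv ℝ (gradient u) (x₀ + t • ξ) ξ)) t := by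
      filter_upwards [hmem] with t htm
      have l := hasDerivAt_line x₀ ξ t
      have a1 := (hhtd (x₀ + t • ξ)).comp_hasDerivAt t l
      have a2 := (hgd _ htm).comp_hasDerivAt t l
      have a3 := (hhd (gradient u (x₀ + t • ξ))).comp_hasDerivAt t a2
      exact a1.sub (a3.const_mul A)
    have l0 := hasDerivAt_line x₀ ξ 0
    have z : x₀ + (0 : ℝ) • ξ = x₀ := by simp
    have b1 : HasDerivAt (fun t : ℝ => fderiv ℝ ht (x₀ + t • ξ))
        (fderiv ℝ (fderiv ℝ ht) x₀ ξ) 0 := by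
      have := (hhtd2 (x₀ + (0 : ℝ) • ξ)).comp_hasDerivAt 0 l0
      rw [z] at this
      exact this
    have b2 : HasDerivAt (fun t : ℝ => gradient u (x₀ + t • ξ)) (P ξ) 0 := by
      have := (hgd (x₀ + (0 : ℝ) • ξ) (by rw [z]; exact hx₀)).comp_hasDerivAt 0 l0
      rw [z] at this
      rw [hP]
      exact this
    have b3 : HasDerivAt (fun t : ℝ => fderiv ℝ (gradient u) (x₀ + t • ξ)) (T ξ) 0 := by
      have hPd' : HasFDerivAt (fderiv ℝ (gradient u)) T (x₀ + (0 : ℝ) • ξ) := by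
        rw [z]; exact hPd
      exact hPd'.comp_hasDerivAt 0 l0
    have b4 : HasDerivAt (fun t : ℝ => fderiv ℝ h (gradient u (x₀ + t • ξ)))
        (fderiv ℝ (fderiv ℝ h) p (P ξ)) 0 := by
      have := (hhd2 (gradient u (x₀ + (0 : ℝ) • ξ))).comp_hasDerivAt 0 b2
      rw [z, ← hp] at this
      exact this
    have b5 := b4.clm_apply (b3.clm_apply (hasDerivAt_const (0 : ℝ) ξ))
    have b6 := (b1.clm_apply (hasDerivAt_const (0 : ℝ) ξ)).sub (b5.const_mul A)
    have hm : IsLocalMax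
        (fun t : ℝ => ht (x₀ + t • ξ) - A * h (gradient u (x₀ + t • ξ))) 0 := by
      have hc : ContinuousAt (fun t : ℝ => x₀ + t • ξ) 0 := by fun_prop
      have hm' : IsLocalMax (fun x => ht x - A * h (gradient u x)) (x₀ + (0 : ℝ) • ξ) := by
        rw [z]; exact hmax
      exact IsLocalMax.comp_continuous (g := fun t : ℝ => x₀ + t • ξ) hm' hc
    have hfin := IsLocalMax.second_deriv_nonpos hd1 b6 hm
    have e : ⟪T β ξ, ξ⟫ = fderiv ℝ h p (T ξ ξ) := by
      rw [hβ', hTsymm β ξ, real_inner_comm, ← hTadj, real_inner_comm]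
    rw [e]
    simp only [map_zero, add_zero, z, ← hP, ← hp] at hfin
    linarith
  · -- derivative of the equation in the direction `β`
    have hmem := line_eventually_mem hΩ hx₀ β
    have l0 := hasDerivAt_line x₀ β 0
    have z : x₀ + (0 : ℝ) • β = x₀ := by simp
    have b2 : HasDerivAt (fun t : ℝ => gradient u (x₀ + t • β)) q 0 := by
      have := (hgd (x₀ + (0 : ℝ) • β) (by rw [z]; exact hx₀)).comp_hasDerivAt 0 l0
      rw [z] at this
      rw [hq, hP]
      exact this
    have b3 : HasDerivAt (fun t : ℝ => fderiv ℝ (gradient u) (x₀ + t • β)) (T β) 0 := by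
      have hPd' : HasFDerivAt (fderiv ℝ (gradient u)) T (x₀ + (0 : ℝ) • β) := by
        rw [z]; exact hPd
      exact hPd'.comp_hasDerivAt 0 l0
    have b4 := hasDerivAt_operator b2 b3 (by simpa [z] using hs x₀ hx₀)
      (by simpa [z] using h1 x₀ hx₀)
    have b5 : HasDerivAt (fun t : ℝ => f (x₀ + t • β, gradient u (x₀ + t • β)) + c)
        (fderiv ℝ f (x₀, p) (β, q)) 0 := by
      have hf' : HasFDerivAt f (fderiv ℝ f (x₀, p))
          (x₀ + (0 : ℝ) • β, gradient u (x₀ + (0 : ℝ) • β)) := by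
        rw [z, ← hp]; rw [← hp] at hf; exact hf.hasFDerivAt
      exact (hf'.comp_hasDerivAt 0 (l0.prodMk b2)).add_const c
    have e : (fun t : ℝ => f (x₀ + t • β, gradient u (x₀ + t • β)) + c) =ᶠ[𝓝 0]
        fun t => lor (gradient u (x₀ + t • β)) * trE (fderiv ℝ (gradient u) (x₀ + t • β)) +
          lor (gradient u (x₀ + t • β)) ^ 3 * ⟪gradient u (x₀ + t • β),
            fderiv ℝ (gradient u) (x₀ + t • β) (gradient u (x₀ + t • β))⟫ := by
      filter_upwards [hmem] with t htm
      rw [← heq _ htm, MinkDiv_eq (hgd _ htm).differentiableAt (h1 _ htm)]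
    have b6 := (b4.congr_of_eventuallyEq e).unique b5
    simp only [z, ← hP, ← hp] at b6
    rw [b6, ← map_add]
    simp
  · -- first order condition
    have hg0 := (hhtd x₀).sub (((hhd (gradient u x₀)).comp x₀ (hgd x₀ hx₀)).const_mul A)
    have h0 := hmax.hasFDerivAt_eq_zero hg0
    refine ext_inner_right ℝ fun ξ => ?_
    have h2 := DFunLike.congr_fun h0 ξ
    simp only [_root_.sub_apply, _root_.smul_apply, ContinuousLinearMap.comp_apply,
      _root_.zero_apply, smul_eq_mul, ← hp, ← hP, hβ'] at h2
    have e : ⟪gradient ht x₀, ξ⟫ = fderiv ℝ ht x₀ ξ := by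
      rw [gradient, InnerProductSpace.toDual_symm_apply]
    have e2 := hs x₀ hx₀ β ξ
    rw [← hP] at e2
    rw [e, real_inner_smul_left, hq, e2]
    linarith

lemma HasDerivAt.nonpos_of_eventually_le {ψ : ℝ → ℝ} {d : ℝ} (h : HasDerivAt ψ d 0)
    (h0 : ∀ᶠ t in 𝓝[>] (0 : ℝ), ψ t ≤ ψ 0) : d ≤ 0 := by
  refine le_of_tendsto h.tendsto_slope_zero_right ?_
  filter_upwards [h0, self_mem_nhdsWithin] with t ht htp
  have : 0 < t⁻¹ := inv_pos.2 htp
  rw [zero_add, smul_eq_mul]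
  exact mul_nonpos_of_nonneg_of_nonpos this.le (by linarith)

lemma HasDerivAt.eventually_lt_of_pos {ψ : ℝ → ℝ} {d : ℝ} (h : HasDerivAt ψ d 0)
    (hd : 0 < d) : ∀ᶠ t in 𝓝[>] (0 : ℝ), ψ 0 < ψ t := by
  filter_upwards [h.tendsto_slope_zero_right.eventually (lt_mem_nhds hd),
    self_mem_nhdsWithin] with t ht htp
  have : 0 < t⁻¹ := inv_pos.2 htp
  rw [zero_add, smul_eq_mul] at ht
  linarith [pos_of_mul_pos_right ht this.le]

/-- Comparison with a paraboloid: some point of a ball of radius `r` has `D²u ≤ 1/r`. -/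
lemma exists_hessian_le {Ω : Set (Euc n)} {x₀ : Euc n} {r : ℝ} (hr : 0 < r)
    (hball : Metric.closedBall x₀ r ⊆ Ω) {u : Euc n → ℝ} (hΩ : IsOpen Ω)
    (hu : ∀ x ∈ Ω, ContDiffAt ℝ (⊤ : ℕ∞) u x) (h1 : ∀ x ∈ Ω, ‖gradient u x‖ < 1) :
    ∃ x ∈ Ω, ∀ ξ, ⟪fderiv ℝ (gradient u) x ξ, ξ⟫ ≤ ‖ξ‖ ^ 2 / r := by
  have hud : ∀ x ∈ Ω, HasFDerivAt u (innerSL ℝ (gradient u x)) x := fun x hx => by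
    have := ((hu x hx).differentiableAt (by simp)).hasFDerivAt
    refine this.congr_fderiv ?_
    ext ξ
    rw [innerSL_apply_apply, gradient, InnerProductSpace.toDual_symm_apply]
  have hgd : ∀ x ∈ Ω, HasFDerivAt (gradient u) (fderiv ℝ (gradient u) x) x := fun x hx =>
    ((hu x hx).gradient_top.differentiableAt (by simp)).hasFDerivAt
  have hcont : ContinuousOn (fun x => u x - ‖x - x₀‖ ^ 2 / (2 * r)) (Metric.closedBall x₀ r) := by
    have : ContinuousOn u (Metric.closedBall x₀ r) := fun x hx =>
      (hu x (hball hx)).continuousAt.continuousWithinAt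
    fun_prop
  obtain ⟨x₁, hx₁, hmax⟩ := (isCompact_closedBall x₀ r).exists_isMaxOn
    ⟨x₀, Metric.mem_closedBall_self hr.le⟩ hcont
  have hmem : x₁ ∈ Ω := hball hx₁
  have hline : ∀ ξ : Euc n, ∀ t : ℝ, x₁ + t • ξ ∈ Ω → HasDerivAt
      (fun t : ℝ => u (x₁ + t • ξ) - ‖x₁ + t • ξ - x₀‖ ^ 2 / (2 * r))
      (⟪gradient u (x₁ + t • ξ), ξ⟫ - ⟪x₁ + t • ξ - x₀, ξ⟫ / r) t := by
    intro ξ t htm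
    have l := hasDerivAt_line x₁ ξ t
    have a1 := (hud _ htm).comp_hasDerivAt t l
    have a2 := ((l.sub_const x₀).norm_sq).div_const (2 * r)
    refine (a1.sub a2).congr_deriv ?_
    rw [innerSL_apply_apply]
    field_simp
  refine ⟨x₁, hmem, fun ξ => ?_⟩
  have hlt : ‖x₁ - x₀‖ < r := by
    by_contra! hge
    have hle : ‖x₁ - x₀‖ ≤ r := by simpa [dist_eq_norm] using hx₁
    have heq : ‖x₁ - x₀‖ = r := le_antisymm hle hge
    have hd := hline (x₀ - x₁) 0 (by simpa using hmem)
    have hz : x₁ + (0 : ℝ) • (x₀ - x₁) = x₁ := by simp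
    have hev : ∀ᶠ t in 𝓝[>] (0 : ℝ),
        u (x₁ + t • (x₀ - x₁)) - ‖x₁ + t • (x₀ - x₁) - x₀‖ ^ 2 / (2 * r) ≤
        u (x₁ + (0 : ℝ) • (x₀ - x₁)) - ‖x₁ + (0 : ℝ) • (x₀ - x₁) - x₀‖ ^ 2 / (2 * r) := by
      filter_upwards [Ioo_mem_nhdsGT (zero_lt_one' ℝ)] with t ht
      rw [hz]
      refine hmax ?_
      rw [Metric.mem_closedBall, dist_eq_norm,
        show x₁ + t • (x₀ - x₁) - x₀ = (1 - t) • (x₁ - x₀) by module, norm_smul, heq,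
        Real.norm_eq_abs, abs_of_pos (by linarith [ht.2])]
      nlinarith [ht.1]
    have h0 := hd.nonpos_of_eventually_le hev
    rw [hz] at h0
    have e1 : ⟪x₁ - x₀, x₀ - x₁⟫ = -r ^ 2 := by
      rw [← neg_sub x₁ x₀, inner_neg_right, real_inner_self_eq_norm_sq, heq]
    have e2 : |⟪gradient u x₁, x₀ - x₁⟫| < r := by
      refine (abs_real_inner_le_norm _ _).trans_lt ?_
      rw [norm_sub_rev, heq]
      have := h1 x₁ hmem
      nlinarith
    rw [e1] at h0
    have e3 : -r ^ 2 / r = -r := by field_simp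
    rw [e3] at h0
    linarith [(abs_lt.1 e2).1]
  have hloc : IsLocalMax (fun x => u x - ‖x - x₀‖ ^ 2 / (2 * r)) x₁ := by
    have hb : Metric.ball x₀ r ∈ 𝓝 x₁ :=
      Metric.isOpen_ball.mem_nhds (by simpa [dist_eq_norm] using hlt)
    exact hmax.isLocalMax (Filter.mem_of_superset hb Metric.ball_subset_closedBall)
  have hz : x₁ + (0 : ℝ) • ξ = x₁ := by simp
  have hm : IsLocalMax
      (fun t : ℝ => u (x₁ + t • ξ) - ‖x₁ + t • ξ - x₀‖ ^ 2 / (2 * r)) 0 := by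
    have hc : ContinuousAt (fun t : ℝ => x₁ + t • ξ) 0 := by fun_prop
    have hm' : IsLocalMax (fun x => u x - ‖x - x₀‖ ^ 2 / (2 * r)) (x₁ + (0 : ℝ) • ξ) := by
      rw [hz]; exact hloc
    exact IsLocalMax.comp_continuous (g := fun t : ℝ => x₁ + t • ξ) hm' hc
  have hd1 := (line_eventually_mem hΩ hmem ξ).mono fun t ht => hline ξ t ht
  have l0 := hasDerivAt_line x₁ ξ 0
  have b2 : HasDerivAt (fun t : ℝ => gradient u (x₁ + t • ξ)) (fderiv ℝ (gradient u) x₁ ξ) 0 := by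
    have := (hgd (x₁ + (0 : ℝ) • ξ) (by rw [hz]; exact hmem)).comp_hasDerivAt 0 l0
    rw [hz] at this
    exact this
  have b3 := (b2.inner ℝ (hasDerivAt_const (0 : ℝ) ξ)).sub
    (((l0.sub_const x₀).inner ℝ (hasDerivAt_const (0 : ℝ) ξ)).div_const r)
  have hfin := IsLocalMax.second_deriv_nonpos hd1 b3 hm
  simp only [inner_zero_right, zero_add, real_inner_self_eq_norm_sq] at hfin
  linarith

/-- Arithmetic–geometric mean inequality for nonnegative symmetric endomorphisms. -/
lemma abs_det_le_trE_pow (hn : 2 ≤ n) {P : Euc n →L[ℝ] Euc n}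
    (hs : ∀ a b, ⟪P a, b⟫ = ⟪a, P b⟫) (hp : ∀ a, 0 ≤ ⟪P a, a⟫) :
    |P.det| ≤ (trE P / n) ^ n := by
  have hn0 : n ≠ 0 := by omega
  have hn' : (0 : ℝ) < n := by exact_mod_cast (by omega : 0 < n)
  have hS : (P : Euc n →ₗ[ℝ] Euc n).IsSymmetric := hs
  have hfr : Module.finrank ℝ (Euc n) = n := by simp
  set l := hS.eigenvalues hfr with hl
  have hl0 : ∀ i, 0 ≤ l i := by
    intro i
    have h1 := hp (hS.eigenvectorBasis hfr i)
    have h2 := hS.apply_eigenvectorBasis hfr i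
    simp only [ContinuousLinearMap.coe_coe] at h2
    rw [h2, real_inner_smul_left, real_inner_self_eq_norm_sq] at h1
    simpa using h1
  have hdet : P.det = ∏ i, l i := by
    have := hS.det_eq_prod_eigenvalues hfr
    simpa using this
  have htr : trE P = ∑ i, l i := by
    have h1 := hS.trace_eq_sum_eigenvalues hfr
    rw [LinearMap.trace_eq_sum_inner _ (EuclideanSpace.basisFun (Fin n) ℝ)] at h1
    rw [trE]
    simp only [EuclideanSpace.basisFun_apply, ContinuousLinearMap.coe_coe] at h1
    have h2 : ∑ i, l i = ∑ i, ((hS.eigenvalues hfr i : ℝ)) := rfl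
    rw [h2]
    refine Eq.trans ?_ h1
    exact Finset.sum_congr rfl fun i _ => real_inner_comm _ _
  have amgm := Real.geom_mean_le_arith_mean_weighted Finset.univ (fun _ : Fin n => (1 : ℝ) / n) l
    (fun _ _ => by positivity) (by simp [hn0]) (fun i _ => hl0 i)
  rw [Real.finsetProd_rpow _ _ (fun i _ => hl0 i), ← Finset.mul_sum] at amgm
  have hprod : 0 ≤ ∏ i, l i := Finset.prod_nonneg fun i _ => hl0 i
  rw [hdet, abs_of_nonneg hprod, htr]
  calc ∏ i, l i = ((∏ i, l i) ^ ((1 : ℝ) / n)) ^ n := by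
        rw [← Real.rpow_natCast, ← Real.rpow_mul hprod]
        simp [hn0]
    _ ≤ ((1 : ℝ) / n * ∑ i, l i) ^ n := by gcongr
    _ = _ := by rw [one_div, div_eq_inv_mul]

/-- A trace bound for the derivative of a gradient map bounds the volume of its image. -/
lemma volume_image_le (hn : 2 ≤ n) {Ω : Set (Euc n)} (hΩ : IsOpen Ω) {g : Euc n → Euc n}
    {m : ℝ} (hg : ∀ x ∈ Ω, DifferentiableAt ℝ g x)
    (hs : ∀ x ∈ Ω, ∀ a b, ⟪fderiv ℝ g x a, b⟫ = ⟪a, fderiv ℝ g x b⟫)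
    (hp : ∀ x ∈ Ω, ∀ a, 0 ≤ ⟪fderiv ℝ g x a, a⟫)
    (hm : ∀ x ∈ Ω, trE (fderiv ℝ g x) ≤ m) :
    volume (g '' Ω) ≤ ENNReal.ofReal ((m / n) ^ n) * volume Ω := by
  refine (addHaar_image_le_lintegral_abs_det_fderiv volume hΩ.measurableSet
    fun x hx => (hg x hx).hasFDerivAt.hasFDerivWithinAt).trans ?_
  rw [← setLIntegral_const]
  refine setLIntegral_mono measurable_const fun x hx => ENNReal.ofReal_le_ofReal ?_
  refine (abs_det_le_trE_pow hn (hs x hx) (hp x hx)).trans ?_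
  have := trE_nonneg (hp x hx)
  gcongr
  exact hm x hx

lemma lor_le_of_compact {s : Set (Euc n)} (hs : IsCompact s) (hb : s ⊆ Metric.ball 0 1) :
    ∃ W : ℝ, 1 ≤ W ∧ ∀ p ∈ s, lor p ≤ W := by
  have hc : ContinuousOn lor s := fun p hp =>
    (hasFDerivAt_lor (by simpa using hb hp)).continuousAt.continuousWithinAt
  obtain ⟨W, hW⟩ := hs.exists_bound_of_continuousOn hc
  exact ⟨max 1 W, le_max_left _ _, fun p hp =>
    (le_abs_self _).trans ((hW p hp).trans (le_max_right _ _))⟩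

/-- The trace of the Hessian is comparable with the Minkowski mean curvature. -/
lemma trE_le_operator {P : Euc n →L[ℝ] Euc n} (hp : ∀ a, 0 ≤ ⟪P a, a⟫) {p : Euc n}
    (hp1 : ‖p‖ < 1) : trE P ≤ lor p * trE P + lor p ^ 3 * ⟪p, P p⟫ := by
  have h1 := one_le_lor hp1
  have h2 := trE_nonneg hp
  have h3 := hp p
  rw [real_inner_comm] at h3
  have h4 : 0 ≤ lor p ^ 3 * ⟪p, P p⟫ := by positivity
  nlinarith

lemma operator_le_trE {P : Euc n →L[ℝ] Euc n} (hs : ∀ a b, ⟪P a, b⟫ = ⟪a, P b⟫)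
    (hp : ∀ a, 0 ≤ ⟪P a, a⟫) {p : Euc n} (hp1 : ‖p‖ < 1) {W : ℝ} (hW : lor p ≤ W) :
    lor p * trE P + lor p ^ 3 * ⟪p, P p⟫ ≤ 2 * W ^ 3 * trE P := by
  have h1 := one_le_lor hp1
  have h2 := trE_nonneg hp
  have h3 := hp p
  have h4 := inner_apply_self_le_trE hs hp p hp1.le
  rw [real_inner_comm]
  have hW1 : 1 ≤ W := h1.trans hW
  have e1 : lor p * trE P ≤ W ^ 3 * trE P := by
    refine mul_le_mul_of_nonneg_right (hW.trans ?_) h2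
    exact le_self_pow₀ hW1 (by norm_num)
  have e2 : lor p ^ 3 * ⟪P p, p⟫ ≤ W ^ 3 * trE P := by gcongr
  linarith

/-- Under the oscillation condition the mean curvature is bounded below. -/
lemma operator_lower_bound (hn : 2 ≤ n) {Ω Ωt : Set (Euc n)} (hΩ : IsOpen Ω)
    (hΩt : IsOpen Ωt) (hb : Bornology.IsBounded Ω) (hbt : Bornology.IsBounded Ωt)
    (hne : Ω.Nonempty) (hnet : Ωt.Nonempty) {f : Euc n × Euc n → ℝ} (hosc : OSCcond Ω Ωt f)
    {c : ℝ} {g : Euc n → Euc n} (hg : ∀ x ∈ Ω, DifferentiableAt ℝ g x)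
    (hs : ∀ x ∈ Ω, ∀ a b, ⟪fderiv ℝ g x a, b⟫ = ⟪a, fderiv ℝ g x b⟫)
    (hp : ∀ x ∈ Ω, ∀ a, 0 ≤ ⟪fderiv ℝ g x a, a⟫) (hgΩ : g '' Ω = Ωt)
    (htr : ∀ x ∈ Ω, trE (fderiv ℝ g x) ≤ f (x, g x) + c) :
    ∀ x ∈ Ω, ((n : ℝ) / 2) * ((volume Ωt).toReal / (volume Ω).toReal) ^ ((1 : ℝ) / n) ≤
      f (x, g x) + c := by
  intro x hx
  by_contra! hlt
  have hn0 : n ≠ 0 := by omega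
  have hn' : (0 : ℝ) < n := by exact_mod_cast (by omega : 0 < n)
  have hV : 0 < (volume Ω).toReal :=
    ENNReal.toReal_pos (hΩ.measure_pos volume hne).ne' hb.measure_lt_top.ne
  have hVt : 0 < (volume Ωt).toReal :=
    ENNReal.toReal_pos (hΩt.measure_pos volume hnet).ne' hbt.measure_lt_top.ne
  set V := (volume Ω).toReal with hVdef
  set Vt := (volume Ωt).toReal with hVtdef
  set R := (Vt / V) ^ ((1 : ℝ) / n) with hR
  set m := f (x, g x) + c + (n : ℝ) / 2 * R with hm
  have hgmem : ∀ y ∈ Ω, g y ∈ Ωt := fun y hy => hgΩ ▸ mem_image_of_mem g hy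
  have htm : ∀ y ∈ Ω, trE (fderiv ℝ g y) ≤ m := by
    intro y hy
    have h1 := hosc y (subset_closure hy) x (subset_closure hx) (g y)
      (subset_closure (hgmem y hy)) (g x) (subset_closure (hgmem x hx))
    have h2 := (abs_le.1 h1).2
    have h3 := htr y hy
    linarith
  have hm0 : 0 ≤ m := (trE_nonneg (hp x hx)).trans (htm x hx)
  have hvol := volume_image_le hn hΩ hg hs hp htm
  rw [hgΩ] at hvol
  have hvol' : Vt ≤ (m / n) ^ n * V := by
    have := ENNReal.toReal_mono (ENNReal.mul_ne_top ENNReal.ofReal_ne_top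
      hb.measure_lt_top.ne) hvol
    rwa [ENNReal.toReal_mul, ENNReal.toReal_ofReal (by positivity)] at this
  have hmn : m / n < R := by
    rw [div_lt_iff₀ hn']
    linarith
  have hRn : R ^ n = Vt / V := by
    rw [hR, ← Real.rpow_natCast, ← Real.rpow_mul (by positivity)]
    simp [hn0]
  have hlt2 : (m / n) ^ n < Vt / V := by
    rw [← hRn]
    exact pow_lt_pow_left₀ hmn (by positivity) hn0
  have := mul_lt_mul_of_pos_right hlt2 hV
  rw [div_mul_cancel₀ _ hV.ne'] at this
  linarith

lemma inner_gradient (h : Euc n → ℝ) (x a : Euc n) : ⟪gradient h x, a⟫ = fderiv ℝ h x a := by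
  rw [gradient, InnerProductSpace.toDual_symm_apply]

/-- The barrier inequality at a boundary point yields the double oblique bound. -/
lemma oblique_bound_of_barrier (hn : 2 ≤ n) {Ω : Set (Euc n)} {ht h u : Euc n → ℝ} {x : Euc n}
    {A δ : ℝ} (hA : 0 ≤ A) (hδ : 0 < δ) (hΩ : Ω = {x | 0 < ht x})
    (hht : ContDiff ℝ (⊤ : ℕ∞) ht) (hh : ContDiff ℝ (⊤ : ℕ∞) h)
    (hH : MatLE (δ • (1 : Matrix (Fin n) (Fin n) ℝ)) (Hess u x))
    (hx : 0 ≤ ht x) (hy : h (gradient u x) ≤ 0)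
    (hnt : ‖gradient ht x‖ = 1) (hnh : ‖gradient h (gradient u x)‖ = 1)
    (hbar : ∀ z ∈ Ω, ht z - A * h (gradient u z) ≤ 0) :
    (fun i => gradient ht x i) ⬝ᵥ ((Hess u x)⁻¹).mulVec (fun i => gradient ht x i) ≤ A := by
  have hpd : (Hess u x).PosDef := by
    have h1 : (δ • (1 : Matrix (Fin n) (Fin n) ℝ)).PosDef := Matrix.PosDef.one.smul hδ
    have h2 := h1.add_posSemidef hH
    simpa using h2
  have hdet : IsUnit (Hess u x).det := (Matrix.isUnit_iff_isUnit_det _).1 hpd.isUnit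
  set b := gradient ht x with hb
  set P := fderiv ℝ (gradient u) x with hP
  set ξ : Euc n := WithLp.toLp 2 ((Hess u x)⁻¹.mulVec (fun i => b i)) with hξ
  have hHξ : (Hess u x).mulVec (fun i => ξ i) = fun i => b i := by
    have : (fun i => ξ i) = (Hess u x)⁻¹.mulVec (fun i => b i) := rfl
    rw [this, mulVec_mulVec, Matrix.mul_nonsing_inv _ hdet, one_mulVec]
  have hinner : ∀ a c : Euc n, (fun i => a i) ⬝ᵥ (fun i => c i) = ⟪a, c⟫ := by
    intro a c
    simp [dotProduct, PiLp.inner_apply, mul_comm]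
  have hPξ : P ξ = b := by
    refine ext_inner_right ℝ fun a => ?_
    rw [hP, hH.inner_symm, real_inner_comm, inner_fderiv_gradient, ← Hess_dotProduct, hHξ, hinner,
      real_inner_comm]
  have hgoal : (fun i => b i) ⬝ᵥ ((Hess u x)⁻¹).mulVec (fun i => b i) = ⟪b, ξ⟫ := by
    rw [← hinner]
  rw [hgoal]
  rcases le_or_gt ⟪b, ξ⟫ 0 with hneg | hpos
  · exact hneg.trans hA
  have l0 := hasDerivAt_line x ξ 0
  have hz : x + (0 : ℝ) • ξ = x := by simp
  have b1 : HasDerivAt (fun t : ℝ => ht (x + t • ξ)) ⟪b, ξ⟫ 0 := by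
    have h1 : HasFDerivAt ht (fderiv ℝ ht x) (x + (0 : ℝ) • ξ) := by
      rw [hz]; exact (hht.differentiable (by simp) x).hasFDerivAt
    rw [hb, inner_gradient]
    exact h1.comp_hasDerivAt 0 l0
  have b2 : HasDerivAt (fun t : ℝ => gradient u (x + t • ξ)) b 0 := by
    have h1 : HasFDerivAt (gradient u) P (x + (0 : ℝ) • ξ) := by
      rw [hz]; exact (hH.differentiableAt_gradient hn hδ).hasFDerivAt
    rw [← hPξ]
    exact h1.comp_hasDerivAt 0 l0
  have b3 : HasDerivAt (fun t : ℝ => h (gradient u (x + t • ξ)))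
      ⟪gradient h (gradient u x), b⟫ 0 := by
    have h1 : HasFDerivAt h (fderiv ℝ h (gradient u x)) (gradient u (x + (0 : ℝ) • ξ)) := by
      rw [hz]; exact (hh.differentiable (by simp) _).hasFDerivAt
    rw [inner_gradient]
    exact h1.comp_hasDerivAt 0 b2
  have hev : ∀ᶠ t in 𝓝[>] (0 : ℝ),
      ht (x + t • ξ) - A * h (gradient u (x + t • ξ)) ≤
        ht (x + (0 : ℝ) • ξ) - A * h (gradient u (x + (0 : ℝ) • ξ)) := by
    filter_upwards [b1.eventually_lt_of_pos hpos] with t htp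
    rw [hz] at htp ⊢
    have h1 := hbar (x + t • ξ) (by rw [hΩ]; exact hx.trans_lt htp)
    have h2 : A * h (gradient u x) ≤ 0 := mul_nonpos_of_nonneg_of_nonpos hA hy
    linarith
  have hfin := (b1.sub (b3.const_mul A)).nonpos_of_eventually_le hev
  have hcs := real_inner_le_norm (gradient h (gradient u x)) b
  rw [hnh, hnt, one_mul] at hcs
  nlinarith

/-- Two-sided bounds for the Laplacian of a solution. -/
lemma trE_bounds (hn : 2 ≤ n) {Ω Ωt : Set (Euc n)} (hΩ : IsOpen Ω)
    (hΩt : IsOpen Ωt) (hb : Bornology.IsBounded Ω) (hbt : Bornology.IsBounded Ωt)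
    (hne : Ω.Nonempty) (hnet : Ωt.Nonempty) {f : Euc n × Euc n → ℝ} (hosc : OSCcond Ω Ωt f)
    {K : ℝ} (hfK : ∀ z ∈ closure Ω ×ˢ closure Ωt, |f z| ≤ K)
    {c : ℝ} {u : Euc n → ℝ} (hu : ∀ x ∈ Ω, ContDiffAt ℝ (⊤ : ℕ∞) u x)
    (hs : ∀ x ∈ Ω, ∀ a b, ⟪fderiv ℝ (gradient u) x a, b⟫ = ⟪a, fderiv ℝ (gradient u) x b⟫)
    (hp : ∀ x ∈ Ω, ∀ a, 0 ≤ ⟪fderiv ℝ (gradient u) x a, a⟫)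
    (h1 : ∀ x ∈ Ω, ‖gradient u x‖ < 1)
    (heq : ∀ x ∈ Ω, MinkDiv u x = f (x, gradient u x) + c) (himg : gradient u '' Ω = Ωt)
    {W : ℝ} (hW1 : 1 ≤ W) (hW : ∀ p ∈ closure Ωt, lor p ≤ W) {x₀ : Euc n} {r : ℝ} (hr : 0 < r)
    (hball : Metric.closedBall x₀ r ⊆ Ω) {x : Euc n} (hx : x ∈ Ω) :
    ((n : ℝ) / 2) * ((volume Ωt).toReal / (volume Ω).toReal) ^ ((1 : ℝ) / n) / (2 * W ^ 3) ≤
      trE (fderiv ℝ (gradient u) x) ∧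
    trE (fderiv ℝ (gradient u) x) ≤ (W * n + W ^ 3) / r + 2 * K := by
  have hgd : ∀ x ∈ Ω, DifferentiableAt ℝ (gradient u) x := fun x hx =>
    (hu x hx).gradient_top.differentiableAt (by simp)
  have hmem : ∀ x ∈ Ω, gradient u x ∈ closure Ωt := fun x hx =>
    subset_closure (himg ▸ mem_image_of_mem _ hx)
  have hop : ∀ x ∈ Ω, lor (gradient u x) * trE (fderiv ℝ (gradient u) x) +
      lor (gradient u x) ^ 3 * ⟪gradient u x, fderiv ℝ (gradient u) x (gradient u x)⟫ =
        f (x, gradient u x) + c := fun x hx => by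
    rw [← heq x hx, MinkDiv_eq (hgd x hx) (h1 x hx)]
  have htr : ∀ x ∈ Ω, trE (fderiv ℝ (gradient u) x) ≤ f (x, gradient u x) + c := fun x hx =>
    (trE_le_operator (hp x hx) (h1 x hx)).trans (hop x hx).le
  constructor
  · have e1 := operator_lower_bound hn hΩ hΩt hb hbt hne hnet hosc hgd hs hp himg htr x hx
    have e2 := operator_le_trE (hs x hx) (hp x hx) (h1 x hx) (hW _ (hmem x hx))
    rw [hop x hx] at e2
    rw [div_le_iff₀ (by positivity)]
    linarith
  · obtain ⟨z, hz, hzP⟩ := exists_hessian_le hr hball hΩ hu h1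
    have t1 : trE (fderiv ℝ (gradient u) z) ≤ n / r := by
      calc trE (fderiv ℝ (gradient u) z) ≤ ∑ _i : Fin n, 1 / r :=
            Finset.sum_le_sum fun i _ => by
              simpa using hzP (EuclideanSpace.single i 1)
        _ = n / r := by simp [div_eq_mul_inv]
    have t2 : ⟪gradient u z, fderiv ℝ (gradient u) z (gradient u z)⟫ ≤ 1 / r := by
      rw [real_inner_comm]
      refine (hzP _).trans ?_
      gcongr
      exact pow_le_one₀ (norm_nonneg _) (h1 z hz).le
    have hl := hW _ (hmem z hz)
    have hl0 : 0 ≤ lor (gradient u z) := zero_le_one.trans (one_le_lor (h1 z hz))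
    have t3 : lor (gradient u z) * trE (fderiv ℝ (gradient u) z) ≤ W * (n / r) :=
      mul_le_mul hl t1 (trE_nonneg (hp z hz)) (by positivity)
    have t4 : lor (gradient u z) ^ 3 *
        ⟪gradient u z, fderiv ℝ (gradient u) z (gradient u z)⟫ ≤ W ^ 3 * (1 / r) := by
      refine mul_le_mul (pow_le_pow_left₀ hl0 hl 3) t2 ?_ (by positivity)
      rw [real_inner_comm]
      exact hp z hz _
    have t5 : W * (n / r) + W ^ 3 * (1 / r) = (W * n + W ^ 3) / r := by ring
    have t6 := hop z hz
    have k1 := (abs_le.1 (hfK (z, gradient u z) ⟨subset_closure hz, hmem z hz⟩)).1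
    have k2 := (abs_le.1 (hfK (x, gradient u x) ⟨subset_closure hx, hmem x hx⟩)).2
    have := htr x hx
    linarith

/-- The barrier inequality `h̃ ≤ A h(∇u)`, for a coefficient `A` violating the bound that holds
at interior maximum points. -/
lemma barrier_nonpos (hn : 2 ≤ n) {Ω Ωt : Set (Euc n)} {ht h : Euc n → ℝ} {θt θ : ℝ}
    (hdom : DomainSetup Ω Ωt ht h θt θ) {f : Euc n × Euc n → ℝ} {K ε c : ℝ} (hK : 0 ≤ K)
    (hf : C2Bound Ω Ωt f K) (hfx : DxBound Ω Ωt f ε)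
    {u : Euc n → ℝ} (hu : IsSmoothSol Ω Ωt f c u) {W Λ D B τ M A : ℝ}
    (hW : ∀ p ∈ closure Ωt, lor p ≤ W) (hΛ0 : 0 ≤ Λ)
    (hΛ : ∀ x ∈ closure Ω, ‖fderiv ℝ (fderiv ℝ ht) x‖ ≤ Λ)
    (hD : ∀ x ∈ closure Ω, ‖gradient ht x‖ ≤ D) (hB : ∀ p ∈ closure Ωt, ‖gradient h p‖ ≤ B)
    (hε : 0 ≤ ε) (hτ : 0 ≤ τ) (hA : 0 ≤ A)
    (htr : ∀ x ∈ Ω, τ ≤ trE (fderiv ℝ (gradient u) x) ∧ trE (fderiv ℝ (gradient u) x) ≤ M)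
    (hlarge : (W * n + W ^ 3) * Λ + K * D + (3 * W ^ 3 + 3 * W ^ 5) * (D * M) <
      A * (θ * (τ ^ 2 / n)) - A * (ε * B)) :
    ∀ z ∈ Ω, ht z - A * h (gradient u z) ≤ 0 := by
  obtain ⟨hΩ, hΩt, hb, hbt, hne, hnet, hht, hh, hΩe, hΩte, -, -, -, hθ, -, hHh⟩ := hdom
  obtain ⟨huC, ⟨δ, hδ, hH⟩, h1, heq, himg⟩ := hu
  have hgd : ∀ x ∈ closure Ω, DifferentiableAt ℝ (gradient u) x := fun x hx =>
    (hH x hx).differentiableAt_gradient hn hδ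
  have hgc : ContinuousOn (gradient u) (closure Ω) := fun x hx =>
    (hgd x hx).continuousAt.continuousWithinAt
  have hmem : ∀ x ∈ Ω, gradient u x ∈ Ωt := fun x hx => himg ▸ mem_image_of_mem _ hx
  have hmemc : ∀ x ∈ closure Ω, gradient u x ∈ closure Ωt := fun x hx =>
    MapsTo.closure_of_continuousOn hmem hgc hx
  obtain ⟨x₀, hx₀, hmax⟩ := hb.isCompact_closure.exists_isMaxOn hne.closure
    (f := fun x => ht x - A * h (gradient u x))
    (hht.continuous.continuousOn.sub
      (continuousOn_const.mul (hh.continuous.comp_continuousOn hgc)))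
  intro z hz
  refine (hmax (subset_closure hz)).trans ?_
  by_cases hxΩ : x₀ ∈ Ω
  · exfalso
    have hs : ∀ x ∈ Ω, ∀ a b,
        ⟪fderiv ℝ (gradient u) x a, b⟫ = ⟪a, fderiv ℝ (gradient u) x b⟫ :=
      fun x hx => (hH x (subset_closure hx)).inner_symm
    have huA : ∀ x ∈ Ω, ContDiffAt ℝ (⊤ : ℕ∞) u x := fun x hx =>
      huC.contDiffAt (Filter.mem_of_superset (hΩ.mem_nhds hx) subset_closure)
    have hfd : DifferentiableAt ℝ f (x₀, gradient u x₀) :=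
      (hf.1.contDiffAt (prod_mem_nhds
        (Filter.mem_of_superset (hΩ.mem_nhds hxΩ) subset_closure)
        (Filter.mem_of_superset (hΩt.mem_nhds (hmem _ hxΩ)) subset_closure))).differentiableAt
        (by simp)
    have hp := hmemc x₀ hx₀
    obtain ⟨S, hS1, hS2, hS3⟩ := interior_max_conditions hΩ hxΩ huA hs
      (fun x hx => h1 x (subset_closure hx)) heq hfd hht hh
      (hmax.isLocalMax (Filter.mem_of_superset (hΩ.mem_nhds hxΩ) subset_closure)) rfl rfl rfl rfl
    have hFx : fderiv ℝ f (x₀, gradient u x₀) (gradient h (gradient u x₀), 0) ≤ ε * B := by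
      have hcomp : HasFDerivAt (fun x' => f (x', gradient u x₀))
          ((fderiv ℝ f (x₀, gradient u x₀)).comp (ContinuousLinearMap.inl ℝ (Euc n) (Euc n))) x₀ :=
        hfd.hasFDerivAt.comp x₀ (hasFDerivAt_prodMk_left x₀ (gradient u x₀))
      have hle := hfx x₀ hx₀ _ hp
      rw [hcomp.fderiv] at hle
      have := ((fderiv ℝ f (x₀, gradient u x₀)).comp
        (ContinuousLinearMap.inl ℝ (Euc n) (Euc n))).le_of_opNorm_le hle
          (gradient h (gradient u x₀))
      refine (le_abs_self _).trans (this.trans ?_)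
      gcongr
      exact hB _ hp
    have hFp : ∀ q : Euc n, fderiv ℝ f (x₀, gradient u x₀) (0, q) ≤ K * ‖q‖ := fun q => by
      have := (fderiv ℝ f (x₀, gradient u x₀)).le_of_opNorm_le (hf.2 _ ⟨hx₀, hp⟩).2.1 (0, q)
      refine (le_abs_self _).trans (this.trans ?_)
      simp [Prod.norm_def]
    have hHt : ∀ ξ, -Λ * ‖ξ‖ ^ 2 ≤ fderiv ℝ (fderiv ℝ ht) x₀ ξ ξ := fun ξ => by
      have e1 := (fderiv ℝ (fderiv ℝ ht) x₀ ξ).le_of_opNorm_le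
        ((fderiv ℝ (fderiv ℝ ht) x₀).le_of_opNorm_le (hΛ x₀ hx₀) ξ) ξ
      have e2 := neg_abs_le (fderiv ℝ (fderiv ℝ ht) x₀ ξ ξ)
      rw [Real.norm_eq_abs] at e1
      nlinarith
    have hbound := coefficient_bound (D := D) hn (hs x₀ hxΩ)
      (fun a => (by positivity : (0 : ℝ) ≤ δ * ‖a‖ ^ 2).trans ((hH x₀ hx₀).inner_lower a))
      (Hq := fun ζ => fderiv ℝ (fderiv ℝ h) (gradient u x₀) ζ ζ) hS1 hHt
      (fun ζ => (hHh _).inner_upper ζ) hS2 hFx (hFp _)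
      (by
        have := hD x₀ hx₀
        rwa [← hS3, norm_smul, Real.norm_of_nonneg hA] at this)
      hΛ0 hθ.le hA hK (h1 x₀ hx₀).le (one_le_lor (h1 x₀ hx₀)) (hW _ hp) hτ (htr x₀ hxΩ).1
      (htr x₀ hxΩ).2
    linarith
  · have e1 : ht x₀ ≤ 0 := by
      by_contra! hpos
      exact hxΩ (hΩe ▸ hpos)
    have e2 : 0 ≤ h (gradient u x₀) := by
      have hsub : closure Ωt ⊆ {y | 0 ≤ h y} :=
        closure_minimal (fun y hy => by rw [hΩte] at hy; exact le_of_lt (Set.mem_ofPred.1 hy))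
          (isClosed_le continuous_const hh.continuous)
      exact hsub (hmemc x₀ hx₀)
    have := mul_nonneg hA e2
    linarith

theorem statement_14 {n : ℕ} (hn : 2 ≤ n)
    (Ω Ωt : Set (Euc n)) (ht h : Euc n → ℝ) (θt θ : ℝ)
    (hdom : DomainSetup Ω Ωt ht h θt θ)
    (hball : closure Ωt ⊆ Metric.ball (0 : Euc n) 1)
    :
    ∀ K : ℝ, 0 < K →
      ∃ ε C₂₄ : ℝ, 0 < ε ∧ 0 < C₂₄ ∧
        ∀ f : Euc n × Euc n → ℝ, C2Bound Ω Ωt f K → OSCcond Ω Ωt f → DxBound Ω Ωt f ε →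
        ∀ (c : ℝ) (u ut : Euc n → ℝ), IsSmoothSol Ω Ωt f c u → IsLegendre Ω Ωt u ut →
        ∀ y ∈ frontier Ωt,
          (fun i => gradient ht (gradient ut y) i) ⬝ᵥ
              (Hess ut y).mulVec (fun i => gradient ht (gradient ut y) i) ≤ C₂₄ := by
  intro K hK
  obtain ⟨hΩ, hΩt, hb, hbt, hne, hnet, hht, hh, hΩe, hΩte, hnt, hnh, -, hθ, -, -⟩ := id hdom
  have hn' : (0 : ℝ) < n := by exact_mod_cast (by omega : 0 < n)
  obtain ⟨W, hW1, hW⟩ := lor_le_of_compact hbt.isCompact_closure hball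
  obtain ⟨D₀, hD₀⟩ := hb.isCompact_closure.exists_bound_of_continuousOn (f := gradient ht)
    (fun x _ => hht.contDiffAt.gradient_top.continuousAt.continuousWithinAt)
  obtain ⟨Λ₀, hΛ₀⟩ := hb.isCompact_closure.exists_bound_of_continuousOn
    (f := fderiv ℝ (fderiv ℝ ht))
    (((hht.fderiv_right (m := (⊤ : ℕ∞)) (by simp)).continuous_fderiv (by simp)).continuousOn)
  obtain ⟨B₀, hB₀⟩ := hbt.isCompact_closure.exists_bound_of_continuousOn (f := gradient h)
    (fun x _ => hh.contDiffAt.gradient_top.continuousAt.continuousWithinAt)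
  obtain ⟨x₀, hx₀⟩ := hne
  obtain ⟨r, hr, hrΩ⟩ := Metric.nhds_basis_closedBall.mem_iff.1 (hΩ.mem_nhds hx₀)
  have hV : 0 < (volume Ω).toReal :=
    ENNReal.toReal_pos (hΩ.measure_pos volume ⟨x₀, hx₀⟩).ne' hb.measure_lt_top.ne
  have hVt : 0 < (volume Ωt).toReal :=
    ENNReal.toReal_pos (hΩt.measure_pos volume hnet).ne' hbt.measure_lt_top.ne
  set Λ := max Λ₀ 0
  set D := max D₀ 0
  set B := max B₀ 1
  have hB0 : 0 < B := lt_max_of_lt_right one_pos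
  set τ := ((n : ℝ) / 2) * ((volume Ωt).toReal / (volume Ω).toReal) ^ ((1 : ℝ) / n) / (2 * W ^ 3)
    with hτdef
  have hτ : 0 < τ := by positivity
  set M := (W * n + W ^ 3) / r + 2 * K with hM
  set C := (W * n + W ^ 3) * Λ + K * D + (3 * W ^ 3 + 3 * W ^ 5) * (D * M) with hC
  have hC0 : 0 ≤ C := by positivity
  set κ := θ * (τ ^ 2 / n) with hκ
  have hκ0 : 0 < κ := by positivity
  set A := 2 * (C + 1) / κ with hAdef
  have hA : 0 < A := by positivity
  refine ⟨κ / (2 * B), A, by positivity, hA, ?_⟩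
  intro f hf hosc hfx c u ut hu hut y hy
  have hbar : ∀ z ∈ Ω, ht z - A * h (gradient u z) ≤ 0 := by
    refine barrier_nonpos hn hdom hK.le hf hfx hu hW (le_max_right Λ₀ 0)
      (fun x hx => (hΛ₀ x hx).trans (le_max_left _ _))
      (fun x hx => (hD₀ x hx).trans (le_max_left _ _))
      (fun p hp => (hB₀ p hp).trans (le_max_left _ _)) (by positivity) hτ.le hA.le
      (D := D) (B := B) (M := M) (fun x hx => ?_) ?_
    · obtain ⟨huC, ⟨δ, hδ, hH⟩, h1, heq, himg⟩ := hu
      exact trE_bounds hn hΩ hΩt hb hbt ⟨x₀, hx₀⟩ hnet hosc (fun z hz => (hf.2 z hz).1)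
        (fun x hx => huC.contDiffAt (Filter.mem_of_superset (hΩ.mem_nhds hx) subset_closure))
        (fun x hx => (hH x (subset_closure hx)).inner_symm)
        (fun x hx a => (by positivity : (0 : ℝ) ≤ δ * ‖a‖ ^ 2).trans
          ((hH x (subset_closure hx)).inner_lower a))
        (fun x hx => h1 x (subset_closure hx)) heq himg hW1 hW hr hrΩ hx
    · have e : A * κ - A * (κ / (2 * B) * B) = C + 1 := by
        rw [hAdef]
        field_simp
        ring
      change C < A * κ - A * (κ / (2 * B) * B)
      linarith
  obtain ⟨huC, ⟨δ, hδ, hH⟩, h1, heq, himg⟩ := hu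
  have hgc : ContinuousOn (gradient u) (closure Ω) := fun x hx =>
    ((hH x hx).differentiableAt_gradient hn hδ).continuousAt.continuousWithinAt
  have hsub : closure Ωt ⊆ gradient u '' closure Ω :=
    closure_minimal (himg ▸ image_mono subset_closure)
      (hb.isCompact_closure.image_of_continuousOn hgc).isClosed
  obtain ⟨x, hx, rfl⟩ := hsub (frontier_subset_closure hy)
  have hyt : gradient u x ∉ Ωt := by
    have := hy.2
    rwa [hΩt.interior_eq] at this
  have hxΩ : x ∉ Ω := fun hx' => hyt (himg ▸ mem_image_of_mem _ hx')
  have hxf : x ∈ frontier Ω := ⟨hx, by rwa [hΩ.interior_eq]⟩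
  rw [hut.2.2.1 x hx, hut.2.2.2 x hx]
  refine oblique_bound_of_barrier hn hA.le hδ hΩe hht hh (hH x hx) ?_ ?_ (hnt x hxf)
    (hnh _ hy) hbar
  · have hsub : closure Ω ⊆ {x | 0 ≤ ht x} :=
      closure_minimal (fun y hy => by rw [hΩe] at hy; exact le_of_lt (Set.mem_ofPred.1 hy))
        (isClosed_le continuous_const hht.continuous)
    exact hsub hx
  · by_contra! hpos
    exact hyt (hΩte ▸ hpos)

end
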